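/- Let V be a ℂ-vector space, s ≥ 1, and L(u) = Σ_{k=0}^s u^{s−k} L^{(k)} with L^{(0)} = Id and each L^{(k)} an n×n matrix with entries in End(V), satisfying the RLL relation for the fundamental R-matrix. Define V₁ := { w ∈ V : L_{−1,b}(u)w = 0 for all u ∈ ℂ and all b ∈ I with b ≠ 1 }. Then V₁ is stable under the action of the generators with both indices different from ±1: for all a,b ∈ I with a ∉ {1,−1} and b ∉ {1,−1}, and all u ∈ ℂ, one has L_{ab}(u)·V₁ ⊆ V₁. -/

import Mathlib

noncomputable section

/-- The index set `I = {-m,…,-1,(0),1,…,m}` (the value `0` is included iff `zero = true`). -/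
def Idx (m : ℤ) (zero : Bool) : Finset ℤ :=
  if zero then Finset.Icc (-m) m else (Finset.Icc (-m) m).erase 0

/-- The dimension `n` of the fundamental representation: `2m` or `2m+1`. -/
def nDim (m : ℤ) (zero : Bool) : ℤ := if zero then 2 * m + 1 else 2 * m

/-- `β = n/2 - ε`. -/
def betaC (m : ℤ) (zero : Bool) (sgn : ℂ) : ℂ := (nDim m zero : ℂ) / 2 - sgn

/-- The metric `ε_{ab} = ε_a δ_{a,-b}` with `ε_i = 1` for `i ≥ 0`, `ε_{-i} = ε`. -/
def met (sgn : ℂ) (a b : ℤ) : ℂ :=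
  if a = -b then (if 0 ≤ a then 1 else sgn) else 0

/-- The inverse metric `ε^{ab}`, satisfying `Σ_c ε_{ac} ε^{cb} = δ_a^b`. -/
def metUp (sgn : ℂ) (a b : ℤ) : ℂ :=
  if a = -b then (if 0 ≤ b then 1 else sgn) else 0

/-- The fundamental R-matrix
`R(u)^{a₁a₂}_{b₁b₂} = u(u+β) δ^{a₁}_{b₁} δ^{a₂}_{b₂} + (u+β) δ^{a₁}_{b₂} δ^{a₂}_{b₁}
  - ε u ε^{a₁a₂} ε_{b₁b₂}`. -/
def Rmat (m : ℤ) (zero : Bool) (sgn : ℂ) (u : ℂ) (a1 a2 b1 b2 : ℤ) : ℂ :=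
  u * (u + betaC m zero sgn) * (if a1 = b1 then 1 else 0) * (if a2 = b2 then 1 else 0)
    + (u + betaC m zero sgn) * (if a1 = b2 then 1 else 0) * (if a2 = b1 then 1 else 0)
    - sgn * u * metUp sgn a1 a2 * met sgn b1 b2

/-- The RLL relation for a matrix-valued function `L` with entries in a `ℂ`-algebra `A`. -/
def RLL (m : ℤ) (zero : Bool) (sgn : ℂ) {A : Type*} [Ring A] [Algebra ℂ A]
    (L : ℂ → ℤ → ℤ → A) : Prop :=
  ∀ u v : ℂ, ∀ a1 ∈ Idx m zero, ∀ a2 ∈ Idx m zero, ∀ c1 ∈ Idx m zero, ∀ c2 ∈ Idx m zero,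
    (∑ b1 ∈ Idx m zero, ∑ b2 ∈ Idx m zero,
      Rmat m zero sgn (u - v) a1 a2 b1 b2 • (L u b1 c1 * L v b2 c2))
    = ∑ b1 ∈ Idx m zero, ∑ b2 ∈ Idx m zero,
      Rmat m zero sgn (u - v) b1 b2 c1 c2 • (L v a2 b2 * L u a1 b1)

/-- Lowered-index entries `L_{ab}(u) = Σ_c ε_{ac} L^c_b(u)`. -/
def Llow (m : ℤ) (zero : Bool) (sgn : ℂ) {A : Type*} [Ring A] [Algebra ℂ A]
    (L : ℂ → ℤ → ℤ → A) (u : ℂ) (a b : ℤ) : A :=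
  ∑ c ∈ Idx m zero, met sgn a c • L u c b

/-- Lowered-index entries of a single matrix: `M_{ab} = Σ_c ε_{ac} M^c_b`. -/
def lowMat (m : ℤ) (zero : Bool) (sgn : ℂ) {A : Type*} [Ring A] [Algebra ℂ A]
    (M : ℤ → ℤ → A) (a b : ℤ) : A :=
  ∑ c ∈ Idx m zero, met sgn a c • M c b

/-- The entries of `L(u)` are polynomial in the spectral parameter `u`. -/
def IsPolyFam {A : Type*} [Ring A] [Algebra ℂ A] (L : ℂ → ℤ → ℤ → A) : Prop :=
  ∃ (N : ℕ) (coef : ℕ → ℤ → ℤ → A), ∀ (u : ℂ) (a b : ℤ),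
    L u a b = ∑ k ∈ Finset.range (N + 1), u ^ k • coef k a b

section Helpers

open Polynomial

variable {V : Type*} [AddCommGroup V] [Module ℂ V]

lemma one_mem_Idx {m : ℤ} (zero : Bool) (hm : 1 ≤ m) : (1 : ℤ) ∈ Idx m zero := by
  unfold Idx
  split_ifs <;> simp <;> omega

lemma neg_mem_Idx {m : ℤ} {zero : Bool} {a : ℤ} (ha : a ∈ Idx m zero) : -a ∈ Idx m zero := by
  unfold Idx at *
  split_ifs at * <;> simp at * <;> omega

lemma betaC_ne_zero {m : ℤ} {zero : Bool} {sgn : ℂ} (hm : 1 ≤ m)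
    (hsgn : sgn = 1 ∨ sgn = -1) {a : ℤ} (ha : a ∈ Idx m zero) (ha1 : a ≠ 1) (ha2 : a ≠ -1) :
    betaC m zero sgn ≠ 0 := by
  have hn : 3 ≤ nDim m zero := by
    unfold Idx at ha
    unfold nDim
    split_ifs at * <;> simp at ha <;> omega
  intro h
  unfold betaC at h
  rcases hsgn with rfl | rfl
  · have h2 : ((nDim m zero : ℤ) : ℂ) = ((2 : ℤ) : ℂ) := by push_cast; linear_combination 2 * h
    have := Int.cast_injective h2
    omega
  · have h2 : ((nDim m zero : ℤ) : ℂ) = ((-2 : ℤ) : ℂ) := by push_cast; linear_combination 2 * h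
    have := Int.cast_injective h2
    omega

/-- A lowered-index entry is a multiple of a single matrix entry. -/
lemma Llow_eq (m : ℤ) (zero : Bool) (sgn : ℂ) (L : ℂ → ℤ → ℤ → Module.End ℂ V) (u : ℂ)
    {a : ℤ} (ha : a ∈ Idx m zero) (b : ℤ) :
    Llow m zero sgn L u a b = met sgn a (-a) • L u (-a) b := by
  unfold Llow
  refine Finset.sum_eq_single_of_mem (-a) (neg_mem_Idx ha) fun c _ hc => ?_
  have : a ≠ -c := by omega
  simp [met, this]

/-- Contraction of the lower indices of the R-matrix when the metric term is absent. -/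
lemma sum_Rmat_smul_of_ne {m : ℤ} {zero : Bool} (sgn x : ℂ) {a1 a2 : ℤ}
    (h1 : a1 ∈ Idx m zero) (h2 : a2 ∈ Idx m zero) (hne : a1 ≠ -a2) (f : ℤ → ℤ → V) :
    ∑ b1 ∈ Idx m zero, ∑ b2 ∈ Idx m zero, Rmat m zero sgn x a1 a2 b1 b2 • f b1 b2
      = (x * (x + betaC m zero sgn)) • f a1 a2 + (x + betaC m zero sgn) • f a2 a1 := by
  simp [Rmat, metUp, hne, add_smul, Finset.sum_add_distrib, ite_smul, mul_ite, h1, h2]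

/-- Contraction of the upper indices of the R-matrix against a tensor supported on the first
index being `1`. -/
lemma sum_smul_Rmat_of_support {m : ℤ} {zero : Bool} {sgn : ℂ} (hm : 1 ≤ m)
    (hsgn : sgn = 1 ∨ sgn = -1) (x : ℂ) {c1 c2 : ℤ}
    (h1 : c1 ∈ Idx m zero) (h2 : c2 ∈ Idx m zero) (f : ℤ → ℤ → V)
    (hf : ∀ b1 ∈ Idx m zero, b1 ≠ 1 → ∀ b2, f b1 b2 = 0) :
    ∑ b1 ∈ Idx m zero, ∑ b2 ∈ Idx m zero, Rmat m zero sgn x b1 b2 c1 c2 • f b1 b2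
      = (x * (x + betaC m zero sgn)) • f c1 c2 + (x + betaC m zero sgn) • f c2 c1
        - (x * met sgn c1 c2) • f 1 (-1) := by
  have hI := one_mem_Idx zero hm
  have hK : ∑ b1 ∈ Idx m zero, ∑ b2 ∈ Idx m zero,
      (sgn * x * metUp sgn b1 b2 * met sgn c1 c2) • f b1 b2
      = (x * met sgn c1 c2) • f 1 (-1) := by
    rw [Finset.sum_eq_single_of_mem 1 hI fun b hb hb1 => by simp [hf b hb hb1],
      Finset.sum_eq_single_of_mem (-1) (neg_mem_Idx hI)]
    · have hs : sgn * sgn = 1 := by rcases hsgn with rfl | rfl <;> norm_num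
      congr 1
      have hup : metUp sgn 1 (-1) = sgn := by simp [metUp]
      rw [hup]
      linear_combination (x * met sgn c1 c2) * hs
    · intro b _ hb
      have : (1 : ℤ) ≠ -b := by omega
      simp [metUp, this]
  rw [← hK]
  simp only [Rmat, sub_smul _ _ (f _ _), add_smul _ _ (f _ _), Finset.sum_add_distrib,
    Finset.sum_sub_distrib]
  simp [ite_smul, mul_ite, h1, h2, add_smul]

/-- The RLL relation with first upper index `1`, applied to a vector killed by the entries
`L^1_b`, `b ≠ 1`. -/
lemma RLL.apply_eq {m : ℤ} {zero : Bool} {sgn : ℂ} (hm : 1 ≤ m) (hsgn : sgn = 1 ∨ sgn = -1)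
    {L : ℂ → ℤ → ℤ → Module.End ℂ V} (hRLL : RLL m zero sgn L) {w : V}
    (hw : ∀ v : ℂ, ∀ b ∈ Idx m zero, b ≠ 1 → L v 1 b w = 0) (u v : ℂ) {a c1 c2 : ℤ}
    (ha : a ∈ Idx m zero) (ha1 : a ≠ -1) (h1 : c1 ∈ Idx m zero) (h2 : c2 ∈ Idx m zero) :
    ((u - v) * (u - v + betaC m zero sgn)) • L u 1 c1 (L v a c2 w)
        + (u - v + betaC m zero sgn) • L u a c1 (L v 1 c2 w)
      = ((u - v) * (u - v + betaC m zero sgn)) • L v a c2 (L u 1 c1 w)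
        + (u - v + betaC m zero sgn) • L v a c1 (L u 1 c2 w)
        - ((u - v) * met sgn c1 c2) • L v a (-1) (L u 1 1 w) := by
  have hI := one_mem_Idx zero hm
  have h := congrArg (fun T : Module.End ℂ V => T w) (hRLL u v 1 hI a ha c1 h1 c2 h2)
  simp only [LinearMap.sum_apply, LinearMap.smul_apply, Module.End.mul_apply] at h
  rwa [sum_Rmat_smul_of_ne sgn (u - v) hI ha (by omega) fun b1 b2 => L u b1 c1 (L v b2 c2 w),
    sum_smul_Rmat_of_support hm hsgn (u - v) h1 h2 (fun b1 b2 => L v a b2 (L u 1 b1 w))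
      fun b hb hb1 b2 => by simp [hw u b hb hb1]] at h

/-- A vector-valued polynomial function vanishing off a finite set vanishes identically. -/
lemma sum_pow_smul_eq_zero_of_finite (s : ℕ) (y : ℕ → V) {S : Set ℂ} (hS : S.Finite)
    (h : ∀ v ∉ S, ∑ k ∈ Finset.range (s + 1), v ^ (s - k) • y k = 0) (v : ℂ) :
    ∑ k ∈ Finset.range (s + 1), v ^ (s - k) • y k = 0 := by
  rw [← Module.forall_dual_apply_eq_zero_iff ℂ]
  intro φ
  let p : ℂ[X] := ∑ k ∈ Finset.range (s + 1), C (φ (y k)) * X ^ (s - k)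
  have hp : ∀ z, p.eval z = φ (∑ k ∈ Finset.range (s + 1), z ^ (s - k) • y k) := fun z => by
    simp only [p, eval_finsetSum, eval_mul, eval_C, eval_pow, eval_X, map_sum, map_smul,
      smul_eq_mul]
    exact Finset.sum_congr rfl fun k _ => mul_comm _ _
  have hp0 : p = 0 := Polynomial.eq_zero_of_infinite_isRoot p <|
    hS.infinite_compl.mono fun z hz => by
      simp only [Set.mem_ofPred_eq, IsRoot, hp, h z hz, map_zero]
  rw [← hp, hp0, eval_zero]

/-- If an operator polynomial `∑ (u + β) ^ i A_i` annihilates the image of `W` under a monic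
operator polynomial `B(u)` preserving `W`, then all `A_i` annihilate `W`. -/
lemma coeff_apply_eq_zero_of_monic (W : Set V) (β : ℂ) (s : ℕ) (Bc : ℕ → Module.End ℂ V)
    (hB0 : Bc 0 = 1) (B : ℂ → Module.End ℂ V)
    (hB : ∀ u, B u = ∑ k ∈ Finset.range (s + 1), u ^ (s - k) • Bc k)
    (hBW : ∀ u, ∀ w ∈ W, B u w ∈ W) (A : ℕ → Module.End ℂ V) (N : ℕ)
    (h : ∀ u, ∀ w ∈ W, ∑ i ∈ Finset.range N, (u + β) ^ i • A i (B u w) = 0) :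
    ∀ i < N, ∀ w ∈ W, A i w = 0 := by
  induction N with
  | zero => simp
  | succ N ih =>
    have htop : ∀ w ∈ W, A N w = 0 := by
      intro w hw
      rw [← Module.forall_dual_apply_eq_zero_iff ℂ]
      intro φ
      let p : ℂ[X] := ∑ i ∈ Finset.range (N + 1), ∑ k ∈ Finset.range (s + 1),
        C (φ (A i (Bc k w))) * ((X + C β) ^ i * X ^ (s - k))
      have hp0 : p = 0 := by
        refine Polynomial.funext fun z => ?_
        have hz := congrArg φ (h z w hw)
        simp only [hB, LinearMap.sum_apply, LinearMap.smul_apply, map_sum, map_smul, smul_eq_mul,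
          map_zero, Finset.mul_sum] at hz
        simp only [p, eval_finsetSum, eval_mul, eval_C, eval_pow, eval_add, eval_X, eval_zero]
        rw [← hz]
        exact Finset.sum_congr rfl fun i _ => Finset.sum_congr rfl fun k _ => by ring
      have hc : p.coeff (N + s) = φ (A N w) := by
        have hterm : ∀ i k, i ≤ N → k ≤ s → (i, k) ≠ (N, 0) →
            (C (φ (A i (Bc k w))) * ((X + C β) ^ i * X ^ (s - k))).coeff (N + s) = 0 := by
          intro i k hi hk hne
          have hlt : i < N + s - (s - k) := by
            simp only [ne_eq, Prod.mk.injEq, not_and] at hne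
            omega
          rw [coeff_C_mul, coeff_mul_X_pow', if_pos (by omega), coeff_X_add_C_pow,
            Nat.choose_eq_zero_of_lt hlt]
          simp
        simp only [p, finsetSum_coeff]
        rw [Finset.sum_eq_single_of_mem N (by simp), Finset.sum_eq_single_of_mem 0 (by simp)]
        · rw [coeff_C_mul, coeff_mul_X_pow', if_pos (by omega), coeff_X_add_C_pow]
          simp [hB0]
        · intro k hk hk0
          exact hterm N k le_rfl (by simpa [Nat.lt_succ_iff] using hk) (by simpa using hk0)
        · intro i hi hiN
          refine Finset.sum_eq_zero fun k hk => hterm i k ?_ ?_ (by simp [hiN])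
          · simpa [Nat.lt_succ_iff] using hi
          · simpa [Nat.lt_succ_iff] using hk
      rw [← hc, hp0, coeff_zero]
    have hrest := ih fun u w hw => by
      have := h u w hw
      rwa [Finset.sum_range_succ, htop _ (hBW u w hw), smul_zero, add_zero] at this
    intro i hi w hw
    rcases Nat.lt_succ_iff_lt_or_eq.mp hi with hi | rfl
    · exact hrest i hi w hw
    · exact htop w hw

end Helpers

/-- the subspace `V₁` is stable under the generators with indices `≠ ±1`. -/
theorem stmt6 (m : ℤ) (zero : Bool) (sgn : ℂ) (hm : 1 ≤ m)
    (hsgn : sgn = 1 ∨ sgn = -1) (hz : zero = true → sgn = 1)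
    (V : Type*) [AddCommGroup V] [Module ℂ V]
    (s : ℕ) (hs : 1 ≤ s) (Lc : ℕ → ℤ → ℤ → Module.End ℂ V)
    (hLc0 : ∀ a b : ℤ, Lc 0 a b = if a = b then 1 else 0)
    (L : ℂ → ℤ → ℤ → Module.End ℂ V)
    (hL : ∀ (u : ℂ) (a b : ℤ), L u a b = ∑ k ∈ Finset.range (s + 1), u ^ (s - k) • Lc k a b)
    (hRLL : RLL m zero sgn L) :
    ∀ a ∈ Idx m zero, ∀ b ∈ Idx m zero, a ≠ 1 → a ≠ -1 → b ≠ 1 → b ≠ -1 →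
      ∀ u : ℂ, ∀ w : V,
        (∀ v : ℂ, ∀ b' ∈ Idx m zero, b' ≠ 1 → Llow m zero sgn L v (-1) b' w = 0) →
        (∀ v : ℂ, ∀ b' ∈ Idx m zero, b' ≠ 1 →
          Llow m zero sgn L v (-1) b' (Llow m zero sgn L u a b w) = 0) := by
  set β := betaC m zero sgn with hβ
  have hI := one_mem_Idx zero hm
  have hI' := neg_mem_Idx hI
  have hsgn0 : sgn ≠ 0 := by rcases hsgn with rfl | rfl <;> norm_num
  have hmet0 : ∀ c : ℤ, met sgn c (-c) ≠ 0 := fun c => by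
    simp only [met, neg_neg, if_true]
    split_ifs
    exacts [one_ne_zero, hsgn0]
  -- a polynomial identity in `v` may be checked off a finite set
  have hext : ∀ (p q : ℤ) (x : V) (S : Set ℂ), S.Finite → (∀ v ∉ S, L v p q x = 0) →
      ∀ v, L v p q x = 0 := by
    intro p q x S hS h v
    have := sum_pow_smul_eq_zero_of_finite s (fun k => Lc k p q x) hS
      (fun z hz => by simpa [hL] using h z hz) v
    simpa [hL] using this
  let W : Set V := {w | ∀ v : ℂ, ∀ b ∈ Idx m zero, b ≠ 1 → L v 1 b w = 0}
  -- `L^1_1` preserves `W`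
  have hBW : ∀ u, ∀ w ∈ W, L u 1 1 w ∈ W := by
    intro u w hw v c hc hc1
    refine hext 1 c _ {u, u + β, u + β - 1} (by simp) (fun v hv => ?_) v
    simp only [Set.mem_insert_iff, Set.mem_singleton_iff, not_or] at hv
    obtain ⟨hv1, hv2, hv3⟩ := hv
    have hx : u - v ≠ 0 := fun h => hv1 (by linear_combination -h)
    have hxβ : u - v + β ≠ 0 := fun h => hv2 (by linear_combination -h)
    have hxβ1 : u - v + β - 1 ≠ 0 := fun h => hv3 (by linear_combination -h)
    have h := RLL.apply_eq hm hsgn hRLL hw u v hI (by norm_num) hI hc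
    rw [hw v c hc hc1, hw u c hc hc1] at h
    simp only [map_zero, smul_zero, add_zero] at h
    by_cases hcm : c = -1
    · subst hcm
      have hmet : met sgn 1 (-1) = 1 := by simp [met]
      rw [hmet, ← sub_smul] at h
      refine (smul_eq_zero.mp h.symm).resolve_left ?_
      rw [show (u - v) * (u - v + β) - (u - v) * 1 = (u - v) * (u - v + β - 1) by ring]
      exact mul_ne_zero hx hxβ1
    · have hmet : met sgn 1 c = 0 := by
        have : (1 : ℤ) ≠ -c := by omega
        simp [met, this]
      rw [hmet, mul_zero, zero_smul, sub_zero] at h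
      exact (smul_eq_zero.mp h.symm).resolve_left (mul_ne_zero hx hxβ)
  intro a ha b hb ha1 ham1 hb1 hbm1 u w hw v b' hb' hb'1
  have hlow : ∀ (v : ℂ) (c : ℤ), Llow m zero sgn L v (-1) c = met sgn (-1) 1 • L v 1 c :=
    fun v c => by simpa using Llow_eq m zero sgn L v hI' c
  have hmet1 : met sgn (-1) 1 ≠ 0 := by simpa using hmet0 (-1)
  have hwW : w ∈ W := fun v c hc hc1 => by
    have := hw v c hc hc1
    rw [hlow, LinearMap.smul_apply] at this
    exact (smul_eq_zero.mp this).resolve_left hmet1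
  have hna := neg_mem_Idx ha
  have hna1 : -a ≠ 1 := by omega
  have hnam1 : -a ≠ -1 := by omega
  have hβ0 : β ≠ 0 := betaC_ne_zero hm hsgn ha ha1 ham1
  -- crossing symmetry at `u - v = -β`
  have hcross : ∀ u, ∀ w ∈ W, L (u + β) (-a) (-1) (L u 1 1 w) = 0 := by
    intro u w hw
    have h := RLL.apply_eq hm hsgn hRLL hw u (u + β) hna hnam1 ha hna
    rw [hw u a ha ha1, hw u (-a) hna hna1, ← hβ] at h
    simp only [map_zero, smul_zero, add_zero, show u - (u + β) + β = 0 by ring, mul_zero,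
      zero_smul, zero_sub] at h
    refine (smul_eq_zero.mp (neg_eq_zero.mp h.symm)).resolve_left (mul_ne_zero ?_ (hmet0 a))
    simpa using hβ0
  have hcol : ∀ v, ∀ w ∈ W, L v (-a) (-1) w = 0 := by
    have hA := coeff_apply_eq_zero_of_monic W β s (fun k => Lc k 1 1) (by simp [hLc0])
      (fun u => L u 1 1) (fun u => hL u 1 1) hBW (fun i => Lc (s - i) (-a) (-1)) (s + 1)
      (fun u w hw => by
        rw [← hcross u w hw, hL (u + β), LinearMap.sum_apply, ← Finset.sum_range_reflect]
        refine Finset.sum_congr rfl fun k hk => ?_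
        have hk' : k < s + 1 := Finset.mem_range.mp hk
        rw [LinearMap.smul_apply, show s + 1 - 1 - k = s - k by omega,
          show s - (s - k) = k by omega])
    intro v w hw
    rw [hL, LinearMap.sum_apply]
    refine Finset.sum_eq_zero fun k hk => ?_
    have hk' : k < s + 1 := Finset.mem_range.mp hk
    have := hA (s - k) (by omega) w hw
    rw [show s - (s - k) = k by omega] at this
    rw [LinearMap.smul_apply, this, smul_zero]
  rw [hlow, Llow_eq m zero sgn L u ha b, LinearMap.smul_apply, LinearMap.smul_apply, map_smul]
  suffices h : ∀ v, L v 1 b' (L u (-a) b w) = 0 by rw [h v, smul_zero, smul_zero]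
  refine hext 1 b' _ {u, u - β} (by simp) fun v hv => ?_
  simp only [Set.mem_insert_iff, Set.mem_singleton_iff, not_or] at hv
  obtain ⟨hv1, hv2⟩ := hv
  have hx : v - u ≠ 0 := fun h => hv1 (by linear_combination h)
  have hxβ : v - u + β ≠ 0 := fun h => hv2 (by linear_combination h)
  have h := RLL.apply_eq hm hsgn hRLL hwW v u hna hnam1 hb' hb
  rw [hwW u b hb hb1, hwW v b hb hb1, hwW v b' hb' hb'1, hcol u _ (hBW v w hwW)] at h
  simp only [map_zero, smul_zero, add_zero, sub_zero] at h
  exact (smul_eq_zero.mp h).resolve_left (mul_ne_zero hx hxβ)
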